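/- Let b = (b_1, …, b_d) ∈ ℤ^d be an integer point and let I ∪ J be a partition of {1, …, d} with 0 < |I| < |J| such that b_i < 2^{d-2} for every i ∈ I and b_j ≥ 2^{d-2} for every j ∈ J. If b − (d+1)^2·(Σ_{i∈I} e_i − Σ_{j∈J} e_j) ∈ Z^d, then b ∈ S. -/

import Mathlib

open Finset

/-- The 0/1 vector in `ℝ^n` corresponding to a Boolean vector. -/
noncomputable def toVec {n : ℕ} (v : Fin n → Bool) : Fin n → ℝ :=
  fun i => if v i then 1 else 0

/-- The set `S` of degree sequences of hypergraphs on `n` vertices: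
sums of sets of pairwise distinct 0/1 vectors. -/
def degSeqs (n : ℕ) : Set (Fin n → ℝ) :=
  {b | ∃ U : Finset (Fin n → Bool), b = ∑ v ∈ U, toVec v}

/-- The degree-sequence polytope `Z^n`. -/
def dsPolytope (n : ℕ) : Set (Fin n → ℝ) :=
  {p | ∃ c : (Fin n → Bool) → ℝ, (∀ v, 0 ≤ c v ∧ c v ≤ 1) ∧
    p = ∑ v : Fin n → Bool, c v • toVec v}

/-- Integer degree of vertex `k` in the family `U`. -/
def hdeg {d : ℕ} (U : Finset (Fin d → Bool)) (k : Fin d) : ℤ :=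
  ∑ v ∈ U, if v k then 1 else 0

/-- Flip the coordinates in the mask `s`. -/
def hflip {d : ℕ} (s v : Fin d → Bool) : Fin d → Bool := fun k => xor (v k) (s k)

lemma hflip_invol {d : ℕ} (s v : Fin d → Bool) : hflip s (hflip s v) = v := by
  funext k; simp [hflip]

lemma hflip_inj {d : ℕ} (s : Fin d → Bool) : Function.Injective (hflip s) :=
  (show Function.Involutive (hflip s) from hflip_invol s).injective

lemma swap_exists {d : ℕ} (U : Finset (Fin d → Bool)) (P Q : (Fin d → Bool) → Prop)
    [DecidablePred P] [DecidablePred Q] (s : Fin d → Bool)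
    (hPQ : ∀ v, P v → Q (hflip s v))
    (hlt : (U.filter Q).card < (U.filter P).card) :
    ∃ v ∈ U, P v ∧ hflip s v ∉ U := by
  by_contra! h
  refine absurd hlt (not_lt.mpr ?_)
  apply Finset.card_le_card_of_injOn (hflip s)
  · intro v hv
    simp only [Finset.coe_filter, Set.mem_ofPred_eq] at hv ⊢
    exact ⟨h v hv.1 hv.2, hPQ v hv.2⟩
  · exact (hflip_inj s).injOn

lemma swap_deg {d : ℕ} (U : Finset (Fin d → Bool)) (v w : Fin d → Bool)
    (hv : v ∈ U) (hw : w ∉ U) :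
    ∃ U' : Finset (Fin d → Bool), U'.card = U.card ∧
      ∀ l, hdeg U' l = hdeg U l - (if v l then 1 else 0) + (if w l then 1 else 0) := by
  have hw' : w ∉ U.erase v := fun h => hw (Finset.mem_of_mem_erase h)
  refine ⟨insert w (U.erase v), ?_, ?_⟩
  · rw [Finset.card_insert_of_notMem hw', Finset.card_erase_add_one hv]
  · intro l
    unfold hdeg
    rw [Finset.sum_insert hw', ← Finset.add_sum_erase U _ hv]
    ring

lemma hdeg_eq_card {d : ℕ} (U : Finset (Fin d → Bool)) (k : Fin d) :
    hdeg U k = ((U.filter (fun v => v k = true)).card : ℤ) := by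
  simp [hdeg]

lemma card_eq_add {d : ℕ} (U : Finset (Fin d → Bool)) (k : Fin d) :
    (U.card : ℤ) = hdeg U k + ((U.filter (fun v => v k = false)).card : ℤ) := by
  rw [hdeg_eq_card]
  have := Finset.card_filter_add_card_filter_not (s := U) (fun v => v k = true)
  simp only [Bool.not_eq_true] at this
  exact_mod_cast this.symm

lemma move_up {d : ℕ} (U : Finset (Fin d → Bool)) (k : Fin d) (h : 2 * hdeg U k < U.card) :
    ∃ U' : Finset (Fin d → Bool), U'.card = U.card ∧
      ∀ l, hdeg U' l = hdeg U l + (if l = k then 1 else 0) := by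
  have h1 := card_eq_add U k
  have h2 := hdeg_eq_card U k
  obtain ⟨v, hv, hvk, hn⟩ := swap_exists U (fun v => v k = false) (fun v => v k = true)
    (fun l => decide (l = k)) (by intro v hv; simp [hflip, hv]) (by omega)
  obtain ⟨U', hc, hd⟩ := swap_deg U v _ hv hn
  refine ⟨U', hc, fun l => ?_⟩
  rw [hd l]
  by_cases hl : l = k
  · subst hl; simp [hflip, hvk]
  · simp [hflip, hl]

lemma move_down {d : ℕ} (U : Finset (Fin d → Bool)) (k : Fin d) (h : U.card < 2 * hdeg U k) :
    ∃ U' : Finset (Fin d → Bool), U'.card = U.card ∧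
      ∀ l, hdeg U' l = hdeg U l - (if l = k then 1 else 0) := by
  have h1 := card_eq_add U k
  have h2 := hdeg_eq_card U k
  obtain ⟨v, hv, hvk, hn⟩ := swap_exists U (fun v => v k = true) (fun v => v k = false)
    (fun l => decide (l = k)) (by intro v hv; simp [hflip, hv]) (by omega)
  obtain ⟨U', hc, hd⟩ := swap_deg U v _ hv hn
  refine ⟨U', hc, fun l => ?_⟩
  rw [hd l]
  by_cases hl : l = k
  · subst hl; simp [hflip, hvk]
  · simp [hflip, hl]

lemma move_transfer {d : ℕ} (U : Finset (Fin d → Bool)) (i j : Fin d) (hij : i ≠ j)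
    (h : hdeg U i < hdeg U j) :
    ∃ U' : Finset (Fin d → Bool), U'.card = U.card ∧
      ∀ l, hdeg U' l = hdeg U l + (if l = i then 1 else 0) - (if l = j then 1 else 0) := by
  have key : hdeg U j + ((U.filter (fun v => v i = true ∧ v j = false)).card : ℤ)
      = hdeg U i + ((U.filter (fun v => v j = true ∧ v i = false)).card : ℤ) := by
    rw [Finset.card_filter, Finset.card_filter]
    push_cast
    unfold hdeg
    rw [← Finset.sum_add_distrib, ← Finset.sum_add_distrib]
    refine Finset.sum_congr rfl fun v _ => ?_
    cases v i <;> cases v j <;> simp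
  obtain ⟨v, hv, ⟨hvj, hvi⟩, hn⟩ := swap_exists U (fun v => v j = true ∧ v i = false)
    (fun v => v i = true ∧ v j = false)
    (fun l => decide (l = i ∨ l = j)) (by intro v hv; simp [hflip, hv]) (by omega)
  obtain ⟨U', hc, hd⟩ := swap_deg U v _ hv hn
  refine ⟨U', hc, fun l => ?_⟩
  rw [hd l]
  by_cases hl : l = i
  · subst hl; simp [hflip, hvi, hij]
  · by_cases hl' : l = j
    · subst hl'; simp [hflip, hvj, hl]
    · simp [hflip, hl, hl']

lemma add_pair {d : ℕ} (U : Finset (Fin d → Bool)) (hd : 0 < d) (h : U.card < 2 ^ (d - 1)) :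
    ∃ U' : Finset (Fin d → Bool), U'.card = U.card + 2 ∧ ∀ l, hdeg U' l = hdeg U l + 1 := by
  have hex : ∃ v, v ∉ U ∧ hflip (fun _ => true) v ∉ U := by
    by_contra! hc
    have hsub : (Finset.univ : Finset (Fin d → Bool)) ⊆ U ∪ U.image (hflip (fun _ => true)) := by
      intro v _
      rw [Finset.mem_union, Finset.mem_image]
      by_cases hv : v ∈ U
      · exact Or.inl hv
      · exact Or.inr ⟨_, hc v hv, hflip_invol _ _⟩
    have h1 := Finset.card_le_card hsub
    have h2 := Finset.card_union_le U (U.image (hflip (fun _ => true)))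
    have h3 := Finset.card_image_le (s := U) (f := hflip (fun _ => true))
    have h4 : (Finset.univ : Finset (Fin d → Bool)).card = 2 ^ d := by simp
    have h5 : 2 ^ d = 2 * 2 ^ (d - 1) := by
      rw [← pow_succ']; congr 1; omega
    omega
  obtain ⟨v, hv, hw⟩ := hex
  have hne : v ≠ hflip (fun _ => true) v := by
    intro he
    have := congrFun he ⟨0, hd⟩
    simp [hflip] at this
  have hv' : v ∉ insert (hflip (fun _ => true) v) U := by
    simp [hne, hv]
  refine ⟨insert v (insert (hflip (fun _ => true) v) U), ?_, ?_⟩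
  · rw [Finset.card_insert_of_notMem hv', Finset.card_insert_of_notMem hw]
  · intro l
    unfold hdeg
    rw [Finset.sum_insert hv', Finset.sum_insert hw]
    cases hl : v l <;> simp [hflip, hl] <;> ring

lemma finish {d : ℕ} (b : Fin d → ℤ) : ∀ (n : ℕ) (U : Finset (Fin d → Bool)),
    (∑ k, (hdeg U k - b k).natAbs = n) →
    (∀ k, (hdeg U k ≤ b k ∧ 2 * b k ≤ U.card + 1) ∨ (b k ≤ hdeg U k ∧ (U.card : ℤ) - 1 ≤ 2 * b k)) →
    ∃ U' : Finset (Fin d → Bool), ∀ k, hdeg U' k = b k := by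
  intro n
  induction n using Nat.strong_induction_on with
  | _ n ih =>
    intro U hn hU
    by_cases hall : ∀ k, hdeg U k = b k
    · exact ⟨U, hall⟩
    · push Not at hall
      obtain ⟨k, hk⟩ := hall
      have hgo : ∀ U' : Finset (Fin d → Bool), U'.card = U.card →
          (∀ l, l ≠ k → hdeg U' l = hdeg U l) →
          ((hdeg U k < b k ∧ hdeg U' k = hdeg U k + 1) ∨
            (b k < hdeg U k ∧ hdeg U' k = hdeg U k - 1)) →
          ∃ U' : Finset (Fin d → Bool), ∀ k, hdeg U' k = b k := by
        intro U' hc hl hkk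
        refine ih (∑ k, (hdeg U' k - b k).natAbs) ?_ U' rfl ?_
        · rw [← hn]
          apply Finset.sum_lt_sum
          · intro l _
            by_cases h : l = k
            · subst h; omega
            · rw [hl l h]
          · exact ⟨k, Finset.mem_univ _, by omega⟩
        · intro l
          rw [hc]
          by_cases h : l = k
          · subst h
            have := hU l
            omega
          · rw [hl l h]; exact hU l
      rcases hU k with h | h
      · obtain ⟨U', hc, hd⟩ := move_up U k (by omega)
        refine hgo U' hc (fun l hl => by rw [hd l]; simp [hl]) (Or.inl ⟨by omega, by rw [hd k]; simp⟩)
      · obtain ⟨U', hc, hd⟩ := move_down U k (by omega)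
        refine hgo U' hc (fun l hl => by rw [hd l]; simp [hl]) (Or.inr ⟨by omega, by rw [hd k]; simp⟩)

lemma transfers {d : ℕ} (b : Fin d → ℤ) (I J : Finset (Fin d)) (hdisj : Disjoint I J)
    (hunion : I ∪ J = Finset.univ) (j0 : Fin d) (hj0 : j0 ∈ J) (hb : ∀ i ∈ I, b i ≤ b j0) :
    ∀ (n : ℕ) (U : Finset (Fin d → Bool)),
    (∀ i ∈ I, hdeg U i ≤ b i) → (∀ j ∈ J, b j ≤ hdeg U j) →
    (∀ j ∈ J, (U.card : ℤ) - 1 ≤ 2 * b j) →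
    (∑ i ∈ I, (b i - hdeg U i) = n) → ((n : ℤ) ≤ hdeg U j0 - b j0) →
    ∃ U' : Finset (Fin d → Bool), ∀ k, hdeg U' k = b k := by
  intro n
  induction n with
  | zero =>
    intro U hI hJ hc hs _
    have hz : ∀ i ∈ I, b i - hdeg U i = 0 := (Finset.sum_eq_zero_iff_of_nonneg
      (fun i hi => by have := hI i hi; omega)).mp (by rw [hs]; rfl)
    refine finish b _ U rfl fun k => ?_
    have hk : k ∈ I ∪ J := by rw [hunion]; exact Finset.mem_univ _
    rcases Finset.mem_union.mp hk with h | h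
    · have := hz k h
      omega
    · exact Or.inr ⟨hJ k h, hc k h⟩
  | succ n ih =>
    intro U hI hJ hc hs hn
    have hex : ∃ i ∈ I, hdeg U i < b i := by
      by_contra! hcon
      have : ∑ i ∈ I, (b i - hdeg U i) ≤ 0 :=
        Finset.sum_nonpos fun i hi => by have := hcon i hi; omega
      push_cast at hs
      omega
    obtain ⟨i, hi, hlt⟩ := hex
    have hij : i ≠ j0 := fun h => Finset.disjoint_left.mp hdisj hi (h ▸ hj0)
    push_cast at hs hn
    obtain ⟨U', hc', hd⟩ := move_transfer U i j0 hij (by have := hb i hi; omega)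
    have hj0I : ∀ l ∈ I, l ≠ j0 := fun l hl h => Finset.disjoint_left.mp hdisj hl (h ▸ hj0)
    have hiJ : ∀ l ∈ J, l ≠ i := fun l hl h => Finset.disjoint_left.mp hdisj hi (h ▸ hl)
    refine ih U' ?_ ?_ ?_ ?_ ?_
    · intro l hl
      have h1 := hI l hl
      have h2 := hj0I l hl
      rw [hd l]
      by_cases h : l = i
      · subst h; simp [h2]; omega
      · simp [h, h2]; omega
    · intro l hl
      have h1 := hJ l hl
      have h2 := hiJ l hl
      rw [hd l]
      by_cases h : l = j0
      · subst h; simp [h2]; omega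
      · simp [h, h2]; omega
    · rw [hc']; exact hc
    · have : ∑ l ∈ I, (b l - hdeg U' l)
          = ∑ l ∈ I, ((b l - hdeg U l) - (if l = i then 1 else 0)) := by
        refine Finset.sum_congr rfl fun l hl => ?_
        rw [hd l]; simp [hj0I l hl]; ring
      rw [this, Finset.sum_sub_distrib, hs]
      simp [hi]
    · rw [hd j0]; simp [hij.symm]; omega

lemma add_pairs {d : ℕ} (hd : 0 < d) (U : Finset (Fin d → Bool)) (h : U.card ≤ 2 ^ (d - 1)) :
    ∀ t : ℕ, ∃ (U' : Finset (Fin d → Bool)) (s : ℕ), s ≤ t ∧ U'.card ≤ 2 ^ (d - 1) + 1 ∧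
      (∀ l, hdeg U' l = hdeg U l + s) ∧ (s = t ∨ 2 ^ (d - 1) ≤ U'.card) := by
  intro t
  induction t with
  | zero => exact ⟨U, 0, le_refl _, by omega, by simp, Or.inl rfl⟩
  | succ t ih =>
    obtain ⟨U', s, hs, hc, hdg, hor⟩ := ih
    by_cases hbig : 2 ^ (d - 1) ≤ U'.card
    · exact ⟨U', s, by omega, hc, hdg, Or.inr hbig⟩
    · obtain ⟨U'', hc'', hd''⟩ := add_pair U' hd (by omega)
      refine ⟨U'', s + 1, by omega, by omega, ?_, Or.inl (by omega)⟩
      intro l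
      rw [hd'' l, hdg l]; push_cast; ring

lemma case_small {d : ℕ} (b : Fin d → ℤ) (I J : Finset (Fin d)) (hdisj : Disjoint I J)
    (hunion : I ∪ J = Finset.univ) (j0 : Fin d) (hj0 : j0 ∈ J)
    (hI : ∀ i ∈ I, 2 * b i ≤ 2 ^ (d - 1)) (hJ : ∀ j ∈ J, 2 ^ (d - 1) ≤ 2 * b j)
    (U : Finset (Fin d → Bool)) (hU : U.card ≤ 2 ^ (d - 1))
    (hIl : ∀ i ∈ I, b i - ((d : ℤ) + 1) ^ 2 - d ≤ hdeg U i)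
    (hIu : ∀ i ∈ I, hdeg U i ≤ b i - ((d : ℤ) + 1) ^ 2 + d)
    (hJl : ∀ j ∈ J, b j + ((d : ℤ) + 1) ^ 2 - d ≤ hdeg U j) :
    ∃ U' : Finset (Fin d → Bool), ∀ k, hdeg U' k = b k := by
  have hd : 0 < d := Fin.pos j0
  have hcast : (((d + 1) ^ 2 - d : ℕ) : ℤ) = ((d : ℤ) + 1) ^ 2 - d := by
    rw [Nat.cast_sub (by nlinarith)]; push_cast; ring
  have hKd : (0 : ℤ) ≤ ((d : ℤ) + 1) ^ 2 - d := by nlinarith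
  obtain ⟨U', s, hs, hc, hdg, hor⟩ := add_pairs hd U hU ((d + 1) ^ 2 - d)
  have hs' : (s : ℤ) ≤ ((d : ℤ) + 1) ^ 2 - d := by rw [← hcast]; exact_mod_cast hs
  have hc' : (U'.card : ℤ) ≤ 2 ^ (d - 1) + 1 := by exact_mod_cast hc
  have hI1 : ∀ i ∈ I, hdeg U' i ≤ b i := fun i hi => by
    have := hIu i hi; rw [hdg i]; omega
  have hJ1 : ∀ j ∈ J, b j ≤ hdeg U' j := fun j hj => by
    have := hJl j hj; rw [hdg j]; omega
  rcases hor with hst | hbig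
  · have hse : (s : ℤ) = ((d : ℤ) + 1) ^ 2 - d := by rw [← hcast, hst]
    have hnn : 0 ≤ ∑ i ∈ I, (b i - hdeg U' i) :=
      Finset.sum_nonneg fun i hi => by have := hI1 i hi; omega
    obtain ⟨n, hn⟩ := Int.eq_ofNat_of_zero_le hnn
    refine transfers b I J hdisj hunion j0 hj0 ?_ n U' hI1 hJ1 ?_ hn ?_
    · intro i hi
      have := hI i hi
      have := hJ j0 hj0
      omega
    · intro j hj
      have := hJ j hj
      omega
    · rw [← hn]
      have h1 : ∑ i ∈ I, (b i - hdeg U' i) ≤ ∑ i ∈ I, (2 * (d : ℤ)) :=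
        Finset.sum_le_sum fun i hi => by have := hIl i hi; rw [hdg i]; omega
      have h2 : (I.card : ℤ) ≤ d := by
        have := Finset.card_le_univ I
        rw [Fintype.card_fin] at this
        exact_mod_cast this
      rw [Finset.sum_const, nsmul_eq_mul] at h1
      have h3 := hJl j0 hj0
      rw [hdg j0, hse]
      nlinarith
  · have hbig' : (2 : ℤ) ^ (d - 1) ≤ U'.card := by exact_mod_cast hbig
    refine finish b _ U' rfl fun k => ?_
    have hk : k ∈ I ∪ J := by rw [hunion]; exact Finset.mem_univ _
    rcases Finset.mem_union.mp hk with h | h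
    · have := hI k h
      exact Or.inl ⟨hI1 k h, by omega⟩
    · have := hJ k h
      exact Or.inr ⟨hJ1 k h, by omega⟩

lemma hdeg_univ {d : ℕ} (k : Fin d) :
    hdeg (Finset.univ : Finset (Fin d → Bool)) k = 2 ^ (d - 1) := by
  have hd : 0 < d := Fin.pos k
  have h1 : ∑ v : Fin d → Bool, (if v k then (1 : ℤ) else 0)
      = ∑ v : Fin d → Bool, (if (hflip (fun _ => true) v) k then (1 : ℤ) else 0) := by
    exact (Equiv.sum_comp (Function.Involutive.toPerm (hflip (d := d) (fun _ => true))
      (hflip_invol _)) (fun v => if v k then (1 : ℤ) else 0)).symm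
  have h2 : ∑ v : Fin d → Bool, (if v k then (1 : ℤ) else 0)
      + ∑ v : Fin d → Bool, (if (hflip (fun _ => true) v) k then (1 : ℤ) else 0) = 2 ^ d := by
    rw [← Finset.sum_add_distrib]
    rw [Finset.sum_congr rfl (g := fun _ => (1 : ℤ))]
    · simp
    · intro v _
      cases h : v k <;> simp [hflip, h]
  have h5 : (2 : ℤ) ^ d = 2 * 2 ^ (d - 1) := by
    rw [← pow_succ']; congr 1; omega
  unfold hdeg
  omega

lemma hdeg_compl {d : ℕ} (U : Finset (Fin d → Bool)) (k : Fin d) :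
    hdeg Uᶜ k = 2 ^ (d - 1) - hdeg U k := by
  rw [← hdeg_univ k]
  have := Finset.sum_add_sum_compl U (fun v : Fin d → Bool => if v k then (1 : ℤ) else 0)
  unfold hdeg
  omega

lemma main_int {d : ℕ} (b : Fin d → ℤ) (I J : Finset (Fin d)) (hdisj : Disjoint I J)
    (hunion : I ∪ J = Finset.univ) (hIne : I.Nonempty) (hJne : J.Nonempty)
    (hI : ∀ i ∈ I, 2 * b i ≤ 2 ^ (d - 1)) (hJ : ∀ j ∈ J, 2 ^ (d - 1) ≤ 2 * b j)
    (U : Finset (Fin d → Bool))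
    (hIl : ∀ i ∈ I, b i - ((d : ℤ) + 1) ^ 2 - d ≤ hdeg U i)
    (hIu : ∀ i ∈ I, hdeg U i ≤ b i - ((d : ℤ) + 1) ^ 2 + d)
    (hJl : ∀ j ∈ J, b j + ((d : ℤ) + 1) ^ 2 - d ≤ hdeg U j)
    (hJu : ∀ j ∈ J, hdeg U j ≤ b j + ((d : ℤ) + 1) ^ 2 + d) :
    ∃ U' : Finset (Fin d → Bool), ∀ k, hdeg U' k = b k := by
  obtain ⟨i0, hi0⟩ := hIne
  obtain ⟨j0, hj0⟩ := hJne
  have hd : 0 < d := Fin.pos j0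
  by_cases hU : U.card ≤ 2 ^ (d - 1)
  · exact case_small b I J hdisj hunion j0 hj0 hI hJ U hU hIl hIu hJl
  · have h5 : 2 ^ d = 2 * 2 ^ (d - 1) := by
      rw [← pow_succ']; congr 1; omega
    have hcc : Uᶜ.card ≤ 2 ^ (d - 1) := by
      have h6 := Finset.card_compl U
      have h7 : Fintype.card (Fin d → Bool) = 2 ^ d := by simp
      omega
    obtain ⟨W, hW⟩ := case_small (fun k => 2 ^ (d - 1) - b k) J I hdisj.symm
      (by rw [Finset.union_comm]; exact hunion) i0 hi0
      (fun j hj => by have := hJ j hj; omega) (fun i hi => by have := hI i hi; omega)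
      Uᶜ hcc
      (fun j hj => by have := hJu j hj; rw [hdeg_compl]; omega)
      (fun j hj => by have := hJl j hj; rw [hdeg_compl]; omega)
      (fun i hi => by have := hIu i hi; rw [hdeg_compl]; omega)
    refine ⟨Wᶜ, fun k => ?_⟩
    have := hW k
    rw [hdeg_compl]
    omega

/-- A point of the polytope has a representation with at most `d` fractional coefficients. -/
lemma few_fractional {d : ℕ} (p : Fin d → ℝ) (hp : p ∈ dsPolytope d) :
    ∃ c : (Fin d → Bool) → ℝ, (∀ v, 0 ≤ c v ∧ c v ≤ 1) ∧ p = ∑ v, c v • toVec v ∧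
      (Finset.univ.filter (fun v => 0 < c v ∧ c v < 1)).card ≤ d := by
  classical
  obtain ⟨c0, hc0, hpc0⟩ := hp
  let A : Set ((Fin d → Bool) → ℝ) :=
    Set.Icc 0 1 ∩ {c | p = ∑ v, c v • toVec v}
  have hA : IsCompact A := by
    apply IsCompact.inter_right isCompact_Icc
    apply isClosed_eq continuous_const
    fun_prop
  have hne : A.Nonempty := ⟨c0, ⟨fun v => (hc0 v).1, fun v => (hc0 v).2⟩, hpc0⟩
  obtain ⟨c, hc⟩ := hA.extremePoints_nonempty (E := (Fin d → Bool) → ℝ) hne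
  rw [mem_extremePoints] at hc
  obtain ⟨⟨⟨hl, hu⟩, hsum⟩, hext⟩ := hc
  refine ⟨c, fun v => ⟨hl v, hu v⟩, hsum, ?_⟩
  by_contra! hcard
  set F := Finset.univ.filter (fun v => 0 < c v ∧ c v < 1) with hF
  have hdep : ¬ LinearIndependent ℝ (fun v : F => toVec v.1) := by
    intro hli
    have := hli.fintype_card_le_finrank
    simp at this
    omega
  rw [Fintype.not_linearIndependent_iff] at hdep
  obtain ⟨g, hg, w, hw⟩ := hdep
  let g' : (Fin d → Bool) → ℝ := fun v => if h : v ∈ F then g ⟨v, h⟩ else 0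
  have hg' : ∑ v, g' v • toVec v = 0 := by
    rw [← hg]
    rw [← Finset.sum_subset (Finset.subset_univ F), ← Finset.sum_coe_sort F]
    · refine Finset.sum_congr rfl fun v _ => ?_
      simp [g']
    · intro v _ hv
      simp [g', hv]
  have hev : ∀ᶠ t : ℝ in nhds 0, ∀ v, (0 ≤ c v + t * g' v ∧ c v + t * g' v ≤ 1) ∧
      (0 ≤ c v - t * g' v ∧ c v - t * g' v ≤ 1) := by
    rw [Filter.eventually_all]
    intro v
    by_cases hv : v ∈ F
    · have hv2 : 0 < c v ∧ c v < 1 := by simpa [hF] using hv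
      have t1 : Filter.Tendsto (fun t : ℝ => c v + t * g' v) (nhds 0) (nhds (c v)) := by
        have : Continuous (fun t : ℝ => c v + t * g' v) := by fun_prop
        simpa using this.tendsto 0
      have t2 : Filter.Tendsto (fun t : ℝ => c v - t * g' v) (nhds 0) (nhds (c v)) := by
        have : Continuous (fun t : ℝ => c v - t * g' v) := by fun_prop
        simpa using this.tendsto 0
      filter_upwards [t1.eventually (lt_mem_nhds hv2.1), t1.eventually (gt_mem_nhds hv2.2),
        t2.eventually (lt_mem_nhds hv2.1), t2.eventually (gt_mem_nhds hv2.2)] with t a1 a2 a3 a4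
      exact ⟨⟨a1.le, a2.le⟩, a3.le, a4.le⟩
    · have : g' v = 0 := by simp [g', hv]
      refine Filter.Eventually.of_forall fun t => ?_
      rw [this]
      simpa using ⟨hl v, hu v⟩
  have hev2 : ∀ᶠ t : ℝ in nhdsWithin 0 (Set.Ioi 0),
      (∀ v, (0 ≤ c v + t * g' v ∧ c v + t * g' v ≤ 1) ∧
      (0 ≤ c v - t * g' v ∧ c v - t * g' v ≤ 1)) ∧ 0 < t :=
    (hev.filter_mono nhdsWithin_le_nhds).and self_mem_nhdsWithin
  obtain ⟨t, ht, htpos⟩ := hev2.exists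
  have m1 : (fun v => c v + t * g' v) ∈ A := by
    refine ⟨⟨fun v => (ht v).1.1, fun v => (ht v).1.2⟩, ?_⟩
    simp only [Set.mem_ofPred_eq, add_smul, mul_smul, Finset.sum_add_distrib]
    rw [← Finset.smul_sum, hg', smul_zero, add_zero]; exact hsum
  have m2 : (fun v => c v - t * g' v) ∈ A := by
    refine ⟨⟨fun v => (ht v).2.1, fun v => (ht v).2.2⟩, ?_⟩
    simp only [Set.mem_ofPred_eq, sub_smul, mul_smul, Finset.sum_sub_distrib]
    rw [← Finset.smul_sum, hg', smul_zero, sub_zero]; exact hsum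
  have hmem : c ∈ openSegment ℝ (fun v => c v + t * g' v) (fun v => c v - t * g' v) := by
    refine ⟨1/2, 1/2, by norm_num, by norm_num, by norm_num, ?_⟩
    funext v
    simp only [Pi.add_apply, Pi.smul_apply, smul_eq_mul]
    ring
  have heq := hext _ m1 _ m2 hmem
  have heq1 : (fun v => c v + t * g' v) = c := by
    exact heq.1
  have := congrFun heq1 w.1
  have hgw : g' w.1 = g w := by simp [g']
  simp only [hgw] at this
  have h0 : t * g w = 0 := by linarith
  rcases mul_eq_zero.mp h0 with h | h
  · exact htpos.ne' h
  · exact hw h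

lemma hdeg_cast {d : ℕ} (U : Finset (Fin d → Bool)) (k : Fin d) :
    ((hdeg U k : ℤ) : ℝ) = (∑ v ∈ U, toVec v) k := by
  rw [Finset.sum_apply]
  unfold hdeg toVec
  push_cast
  rfl

lemma round_exists {d : ℕ} (p : Fin d → ℝ) (hp : p ∈ dsPolytope d) :
    ∃ U : Finset (Fin d → Bool), ∀ k, (hdeg U k : ℝ) ≤ p k ∧ p k ≤ hdeg U k + d := by
  classical
  obtain ⟨c, hc, hsum, hF⟩ := few_fractional p hp
  refine ⟨Finset.univ.filter (fun v => c v = 1), fun k => ?_⟩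
  have hpk : p k = ∑ v, c v * toVec v k := by
    rw [hsum, Finset.sum_apply]; rfl
  have hdk : (hdeg (Finset.univ.filter (fun v => c v = 1)) k : ℝ)
      = ∑ v, if c v = 1 then toVec v k else 0 := by
    rw [hdeg_cast, Finset.sum_apply, Finset.sum_filter]
  have h01 : ∀ v : Fin d → Bool, 0 ≤ toVec v k ∧ toVec v k ≤ 1 := by
    intro v; unfold toVec; split_ifs <;> norm_num
  rw [hdk, hpk]
  constructor
  · refine Finset.sum_le_sum fun v _ => ?_
    split_ifs with h
    · rw [h, one_mul]
    · exact mul_nonneg (hc v).1 (h01 v).1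
  · have hb : ∑ v, c v * toVec v k ≤
        ∑ v, ((if c v = 1 then toVec v k else 0) + (if 0 < c v ∧ c v < 1 then (1 : ℝ) else 0)) := by
      refine Finset.sum_le_sum fun v _ => ?_
      by_cases h1 : c v = 1
      · simp [h1]
      · have h2 : c v < 1 := lt_of_le_of_ne (hc v).2 h1
        by_cases h3 : 0 < c v
        · simp only [h1, h2, h3, and_self, if_true, if_false, zero_add]
          nlinarith [h01 v]
        · have h4 : c v = 0 := le_antisymm (not_lt.mp h3) (hc v).1
          simp [h4]
    rw [Finset.sum_add_distrib] at hb
    have hcd : (∑ v : Fin d → Bool, if 0 < c v ∧ c v < 1 then (1 : ℝ) else 0) ≤ d := by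
      rw [Finset.sum_boole]
      exact_mod_cast hF
    linarith

/-- Theorem (main2): if `I ∪ J` partitions the coordinates with `0 < |I| < |J|`,
`bᵢ < 2^(d-2)` on `I`, `bⱼ ≥ 2^(d-2)` on `J`, and
`b - (d+1)²(∑_{i∈I} eᵢ - ∑_{j∈J} eⱼ) ∈ Z^d`, then `b ∈ S`. -/
theorem theorem_main2 (d : ℕ) (b : Fin d → ℤ) (I J : Finset (Fin d))
    (hdisj : Disjoint I J) (hunion : I ∪ J = Finset.univ)
    (hIpos : 0 < I.card) (hcard : I.card < J.card)
    (hI : ∀ i ∈ I, b i < 2 ^ (d - 2))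
    (hJlb : ∀ j ∈ J, 2 ^ (d - 2) ≤ b j)
    (hZ : (fun k => (b k : ℝ) - ((d : ℝ) + 1) ^ 2 * (if k ∈ I then 1 else -1))
        ∈ dsPolytope d) :
    (fun i => (b i : ℝ)) ∈ degSeqs d := by
  have hd2 : 2 ≤ d := by
    have h1 := Finset.card_union_of_disjoint hdisj
    rw [hunion, Finset.card_univ, Fintype.card_fin] at h1
    omega
  have hpow : (2 : ℤ) ^ (d - 1) = 2 * 2 ^ (d - 2) := by
    rw [← pow_succ']; congr 1; omega
  obtain ⟨U, hU⟩ := round_exists _ hZ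
  have hUI : ∀ i ∈ I, hdeg U i ≤ b i - ((d : ℤ) + 1) ^ 2 ∧
      b i - ((d : ℤ) + 1) ^ 2 ≤ hdeg U i + d := by
    intro i hi
    have h := hU i
    simp only [hi, if_true, mul_one] at h
    exact ⟨by exact_mod_cast h.1, by exact_mod_cast h.2⟩
  have hUJ : ∀ j ∈ J, hdeg U j ≤ b j + ((d : ℤ) + 1) ^ 2 ∧
      b j + ((d : ℤ) + 1) ^ 2 ≤ hdeg U j + d := by
    intro j hj
    have hjI : j ∉ I := fun h => Finset.disjoint_left.mp hdisj h hj
    have h := hU j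
    simp only [hjI, if_false, mul_neg, mul_one, sub_neg_eq_add] at h
    exact ⟨by exact_mod_cast h.1, by exact_mod_cast h.2⟩
  obtain ⟨W, hW⟩ := main_int b I J hdisj hunion (Finset.card_pos.mp hIpos)
    (Finset.card_pos.mp (by omega))
    (fun i hi => by have := hI i hi; omega) (fun j hj => by have := hJlb j hj; omega) U
    (fun i hi => by have := hUI i hi; omega) (fun i hi => by have := hUI i hi; omega)
    (fun j hj => by have := hUJ j hj; omega) (fun j hj => by have := hUJ j hj; omega)
  refine ⟨W, ?_⟩
  funext k
  rw [← hdeg_cast, hW k]
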